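/- For every infinite set I there exists a preordered space (X, ≼) which admits a strict monotone multi-utility indexed by a set of the cardinality of I and whose quotient X/∼ has cardinality 2^|I|; in particular, the power set of I with the trivial ordering (U ≼ V iff U = V) is such a space. -/

import Mathlib

universe u

/-- `f` is a monotone: `x ≼ y` implies `f x ≤ f y`. -/
def IsMonotoneFn {X : Type*} [Preorder X] (f : X → ℝ) : Prop :=
  ∀ x y : X, x ≤ y → f x ≤ f y

/-- `f` is a strict monotone: a monotone such that `x ≺ y` implies `f x < f y`. -/
def IsStrictMonotoneFn {X : Type*} [Preorder X] (f : X → ℝ) : Prop :=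
  IsMonotoneFn f ∧ ∀ x y : X, x < y → f x < f y

/-- A family `(v i)_{i ∈ I}` of real-valued functions is a multi-utility for the
preorder on `X` if `x ≼ y ↔ ∀ i, v i x ≤ v i y`. -/
def IsMultiUtility {X I : Type*} [Preorder X] (v : I → X → ℝ) : Prop :=
  ∀ x y : X, x ≤ y ↔ ∀ i, v i x ≤ v i y

/-- Type synonym carrying the trivial ordering `x ≼ y ↔ x = y`. -/
def TrivialOrder (α : Type u) : Type u := α

/-- The trivial ordering: `x ≼ y` iff `x = y`. -/
instance (α : Type u) : Preorder (TrivialOrder α) where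
  le x y := x = y
  le_refl _ := rfl
  le_trans _ _ _ h h' := Eq.trans h h'

/-- For every infinite set `I`, the power set of `I` equipped with the
trivial ordering (`U ≼ V` iff `U = V`) is a preordered space admitting a strict
monotone multi-utility indexed by a set of the cardinality of `I`, whose quotient
`X/∼` has cardinality `2 ^ |I|`. In particular such a preordered space exists. -/
theorem stmt_10 (I : Type u) [Infinite I] :
    ((∃ (J : Type u) (v : J → TrivialOrder (Set I) → ℝ),
        Cardinal.mk J = Cardinal.mk I ∧ IsMultiUtility v ∧
          ∀ j, IsStrictMonotoneFn (v j)) ∧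
      Cardinal.mk (Antisymmetrization (TrivialOrder (Set I)) (· ≤ ·)) =
        2 ^ Cardinal.mk I) ∧
    ∃ (X : Type u) (_ : Preorder X),
      (∃ (J : Type u) (v : J → X → ℝ), Cardinal.mk J = Cardinal.mk I ∧
        IsMultiUtility v ∧ ∀ j, IsStrictMonotoneFn (v j)) ∧
      Cardinal.mk (Antisymmetrization X (· ≤ ·)) = 2 ^ Cardinal.mk I := by
  classical
  have key : (∃ (J : Type u) (v : J → TrivialOrder (Set I) → ℝ),
        Cardinal.mk J = Cardinal.mk I ∧ IsMultiUtility v ∧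
          ∀ j, IsStrictMonotoneFn (v j)) ∧
      Cardinal.mk (Antisymmetrization (TrivialOrder (Set I)) (· ≤ ·)) =
        2 ^ Cardinal.mk I := by
    have hle : ∀ x y : TrivialOrder (Set I), x ≤ y ↔ x = y := fun _ _ => Iff.rfl
    constructor
    · let g : I → TrivialOrder (Set I) → ℝ :=
        fun i U => if (show Set I from U) i then 1 else 0
      refine ⟨I ⊕ I, Sum.elim g (fun i U => - g i U), ?_, ?_, ?_⟩
      · rw [Cardinal.mk_sum, Cardinal.lift_id]
        exact Cardinal.add_eq_self (Cardinal.aleph0_le_mk I)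
      · intro x y
        constructor
        · intro h i
          rw [(hle x y).1 h]
        · intro h
          rw [hle]
          have hg : ∀ i, g i x = g i y := fun i =>
            le_antisymm (h (Sum.inl i)) (neg_le_neg_iff.1 (h (Sum.inr i)))
          refine Set.ext (α := I) fun i => ?_
          have := hg i
          change (show Set I from x) i ↔ (show Set I from y) i
          simp only [g] at this
          split_ifs at this with h1 h2 h2
          · exact ⟨fun _ => h2, fun _ => h1⟩
          · norm_num at this
          · norm_num at this
          · exact ⟨fun h => absurd h h1, fun h => absurd h h2⟩
      · intro j
        refine ⟨fun x y h => ?_, fun x y h => ?_⟩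
        · rw [(hle x y).1 h]
        · exact absurd ((hle x y).1 h.le) h.ne
    · rw [← Cardinal.mk_set]
      symm
      refine Cardinal.mk_congr (Equiv.ofBijective
        (fun U : Set I => toAntisymmetrization (α := TrivialOrder (Set I)) (· ≤ ·) U) ⟨?_, ?_⟩)
      · intro a b h
        have h2 : AntisymmRel (α := TrivialOrder (Set I)) (· ≤ ·) a b := Quotient.exact h
        exact h2.1
      · intro q
        induction q using Quotient.inductionOn with
        | h a => exact ⟨a, rfl⟩
  exact ⟨key, TrivialOrder (Set I), inferInstance, key⟩
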